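/- arXiv:1911.00360 — 2 statements merged into one kernel-verified Lean document; each statement's English description precedes it below -/
import Mathlib

section
/- Let α be a real 3×3 matrix with entries αᵢⱼ, let Qᵢ(x,y,z) = αᵢ₁ z² + αᵢ₂ xz + αᵢ₃ yz for i = 1,2,3, and let f(x,y,z) = (x, y, Q₁(x,y,z), Q₂(x,y,z), Q₃(x,y,z)). Then f is A²-equivalent to g₅(x,y,z) = (x,y,xz,0,0) if and only if the curvature locus Δ_f is a line through the origin; precisely, if and only if there exists u ∈ ℝ³ with u ≠ 0 such that Δ_f = {t • u : t ∈ ℝ}. -/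
noncomputable section

/-- Two smooth map germs `(ℝ³,0) → (ℝ⁵,0)` are `𝒜²`-equivalent: there are smooth
changes of coordinates in source and target, fixing the origin and with invertible
differential at the origin, such that the composites have the same 2-jet at `0`. -/
def A2Equiv (f g : (Fin 3 → ℝ) → (Fin 5 → ℝ)) : Prop :=
  ∃ (ψ : (Fin 3 → ℝ) → (Fin 3 → ℝ)) (φ : (Fin 5 → ℝ) → (Fin 5 → ℝ))
    (ψ' : (Fin 3 → ℝ) ≃L[ℝ] (Fin 3 → ℝ)) (φ' : (Fin 5 → ℝ) ≃L[ℝ] (Fin 5 → ℝ)),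
    ContDiff ℝ (⊤ : ℕ∞) ψ ∧ ContDiff ℝ (⊤ : ℕ∞) φ ∧ ψ 0 = 0 ∧ φ 0 = 0 ∧
    HasFDerivAt ψ (ψ' : (Fin 3 → ℝ) →L[ℝ] (Fin 3 → ℝ)) 0 ∧
    HasFDerivAt φ (φ' : (Fin 5 → ℝ) →L[ℝ] (Fin 5 → ℝ)) 0 ∧
    ∀ k : ℕ, k ≤ 2 → iteratedFDeriv ℝ k (φ ∘ f ∘ ψ) 0 = iteratedFDeriv ℝ k g 0

def g1 : (Fin 3 → ℝ) → (Fin 5 → ℝ) := fun p => ![p 0, p 1, p 0 * p 2, p 1 * p 2, p 2 ^ 2]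
def g2 : (Fin 3 → ℝ) → (Fin 5 → ℝ) := fun p => ![p 0, p 1, p 2 ^ 2, p 0 * p 2, 0]
def g3 : (Fin 3 → ℝ) → (Fin 5 → ℝ) := fun p => ![p 0, p 1, p 0 * p 2, p 1 * p 2, 0]
def g4 : (Fin 3 → ℝ) → (Fin 5 → ℝ) := fun p => ![p 0, p 1, p 2 ^ 2, 0, 0]
def g5 : (Fin 3 → ℝ) → (Fin 5 → ℝ) := fun p => ![p 0, p 1, p 0 * p 2, 0, 0]
def g6 : (Fin 3 → ℝ) → (Fin 5 → ℝ) := fun p => ![p 0, p 1, 0, 0, 0]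

/-- The curvature locus at the origin of a corank 1 3-manifold in Monge form with
quadratic part `Q = (Q₁,Q₂,Q₃)`: the image of the unit cylinder `a² + b² = 1`
under twice the quadratic part, inside the normal space `ℝ³`. -/
def curvLocus (Q : Fin 3 → (Fin 3 → ℝ) → ℝ) : Set (Fin 3 → ℝ) :=
  {v | ∃ a b c : ℝ, a ^ 2 + b ^ 2 = 1 ∧
    v = ![2 * Q 0 ![a, b, c], 2 * Q 1 ![a, b, c], 2 * Q 2 ![a, b, c]]}

open scoped ContDiff

/-- The first derivative of `φ ∘ c` for a curve `c`. -/
lemma hasDerivAt_comp_curve {E G : Type*} [NormedAddCommGroup E] [NormedSpace ℝ E]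
    [NormedAddCommGroup G] [NormedSpace ℝ G] {φ : E → G} {c : ℝ → E}
    (hφ : ContDiff ℝ ∞ φ) (hc : ContDiff ℝ ∞ c) (t : ℝ) :
    HasDerivAt (φ ∘ c) (fderiv ℝ φ (c t) (deriv c t)) t :=
  ((hφ.differentiable (by simp)).differentiableAt.hasFDerivAt).comp_hasDerivAt t
    (hc.differentiable (by simp)).differentiableAt.hasDerivAt

/-- The second derivative of `φ ∘ c` for a curve `c`. -/
lemma deriv_deriv_comp_curve {E G : Type*} [NormedAddCommGroup E] [NormedSpace ℝ E]
    [NormedAddCommGroup G] [NormedSpace ℝ G] {φ : E → G} {c : ℝ → E}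
    (hφ : ContDiff ℝ ∞ φ) (hc : ContDiff ℝ ∞ c) (t : ℝ) :
    deriv (deriv (φ ∘ c)) t =
      fderiv ℝ (fderiv ℝ φ) (c t) (deriv c t) (deriv c t) +
        fderiv ℝ φ (c t) (deriv (deriv c) t) := by
  have h1 : deriv (φ ∘ c) = fun s => fderiv ℝ φ (c s) (deriv c s) :=
    funext fun s => (hasDerivAt_comp_curve hφ hc s).deriv
  have hφ' : ContDiff ℝ ∞ (fderiv ℝ φ) := hφ.fderiv_right (by simp)
  have hc' : ContDiff ℝ ∞ (deriv c) := ((contDiff_infty_iff_deriv (𝕜 := ℝ)).1 hc).2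
  rw [h1]
  have h2 := hasDerivAt_comp_curve hφ' hc t
  have h3 : HasDerivAt (deriv c) (deriv (deriv c) t) t :=
    (hc'.differentiable (by simp)).differentiableAt.hasDerivAt
  exact (h2.clm_apply h3).deriv

/-- Differentiating along a line through the origin. -/
lemma deriv_line {E : Type*} [NormedAddCommGroup E] [NormedSpace ℝ E] (v : E) :
    deriv (fun t : ℝ => t • v) = fun _ => v := by
  funext t
  simpa using ((hasDerivAt_id t).smul_const v).deriv

lemma contDiff_line {E : Type*} [NormedAddCommGroup E] [NormedSpace ℝ E] (v : E) :
    ContDiff ℝ ∞ (fun t : ℝ => t • v) := by fun_prop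

lemma deriv_comp_line {E G : Type*} [NormedAddCommGroup E] [NormedSpace ℝ E]
    [NormedAddCommGroup G] [NormedSpace ℝ G] {H : E → G} (hH : ContDiff ℝ ∞ H) (v : E) :
    deriv (H ∘ fun t : ℝ => t • v) 0 = fderiv ℝ H 0 v := by
  rw [(hasDerivAt_comp_curve hH (contDiff_line v) 0).deriv, deriv_line]
  simp

lemma deriv_deriv_comp_line {E G : Type*} [NormedAddCommGroup E] [NormedSpace ℝ E]
    [NormedAddCommGroup G] [NormedSpace ℝ G] {H : E → G} (hH : ContDiff ℝ ∞ H) (v : E) :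
    deriv (deriv (H ∘ fun t : ℝ => t • v)) 0 = fderiv ℝ (fderiv ℝ H) 0 v v := by
  rw [deriv_deriv_comp_curve hH (contDiff_line v) 0, deriv_line]
  simp

/-- Derivatives at `0` of a map that is a quadratic polynomial along a line. -/
lemma fderiv_of_quadratic_on_line {E G : Type*} [NormedAddCommGroup E] [NormedSpace ℝ E]
    [NormedAddCommGroup G] [NormedSpace ℝ G] {H : E → G} (hH : ContDiff ℝ ∞ H) {v : E} {a b : G}
    (h : ∀ t : ℝ, H (t • v) = t • a + t ^ 2 • b) :
    fderiv ℝ H 0 v = a ∧ fderiv ℝ (fderiv ℝ H) 0 v v = (2 : ℝ) • b := by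
  have h0 : (H ∘ fun t : ℝ => t • v) = fun t => t • a + t ^ 2 • b := funext h
  have h1 : deriv (fun t : ℝ => t • a + t ^ 2 • b) = fun t => a + (2 * t) • b := by
    funext t
    have := ((hasDerivAt_id t).smul_const a).fun_add (((hasDerivAt_id t).fun_pow 2).smul_const b)
    simpa using this.deriv
  have h2 : deriv (fun t : ℝ => a + (2 * t) • b) 0 = (2 : ℝ) • b := by
    have := ((((hasDerivAt_id (0 : ℝ)).const_mul 2)).smul_const b).const_add a
    simpa using this.deriv
  rw [← deriv_comp_line hH, ← deriv_deriv_comp_line hH, h0, h1]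
  exact ⟨by simp, h2⟩

/-- The second order chain rule for `φ ∘ f ∘ ψ` on the diagonal. -/
lemma fderiv_fderiv_comp_comp {E F G K : Type*} [NormedAddCommGroup E] [NormedSpace ℝ E]
    [NormedAddCommGroup F] [NormedSpace ℝ F] [NormedAddCommGroup G] [NormedSpace ℝ G]
    [NormedAddCommGroup K] [NormedSpace ℝ K] {ψ : E → F} {f : F → G} {φ : G → K}
    (hψ : ContDiff ℝ ∞ ψ) (hf : ContDiff ℝ ∞ f) (hφ : ContDiff ℝ ∞ φ)
    (hψ0 : ψ 0 = 0) (hf0 : f 0 = 0) (v : E) :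
    fderiv ℝ (φ ∘ f ∘ ψ) 0 v = fderiv ℝ φ 0 (fderiv ℝ f 0 (fderiv ℝ ψ 0 v)) ∧
    fderiv ℝ (fderiv ℝ (φ ∘ f ∘ ψ)) 0 v v =
      fderiv ℝ (fderiv ℝ φ) 0 (fderiv ℝ f 0 (fderiv ℝ ψ 0 v)) (fderiv ℝ f 0 (fderiv ℝ ψ 0 v)) +
      fderiv ℝ φ 0 (fderiv ℝ (fderiv ℝ f) 0 (fderiv ℝ ψ 0 v) (fderiv ℝ ψ 0 v) +
        fderiv ℝ f 0 (fderiv ℝ (fderiv ℝ ψ) 0 v v)) := by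
  have hp : ContDiff ℝ ∞ (ψ ∘ fun t : ℝ => t • v) := hψ.comp (contDiff_line v)
  have hc : ContDiff ℝ ∞ (f ∘ ψ ∘ fun t : ℝ => t • v) := hf.comp hp
  have hH : ContDiff ℝ ∞ (φ ∘ f ∘ ψ) := hφ.comp (hf.comp hψ)
  have e : (φ ∘ f ∘ ψ) ∘ (fun t : ℝ => t • v) = φ ∘ (f ∘ (ψ ∘ fun t : ℝ => t • v)) := rfl
  have hp0 : (ψ ∘ fun t : ℝ => t • v) 0 = 0 := by simp [hψ0]
  have hc0 : (f ∘ ψ ∘ fun t : ℝ => t • v) 0 = 0 := by simp [hψ0, hf0]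
  have hc1 : deriv (f ∘ ψ ∘ fun t : ℝ => t • v) 0 = fderiv ℝ f 0 (fderiv ℝ ψ 0 v) := by
    rw [(hasDerivAt_comp_curve hf hp 0).deriv, hp0, deriv_comp_line hψ]
  constructor
  · rw [← deriv_comp_line hH, e, (hasDerivAt_comp_curve hφ hc 0).deriv, hc0, hc1]
  · rw [← deriv_deriv_comp_line hH, e, deriv_deriv_comp_curve hφ hc, hc0, hc1,
      deriv_deriv_comp_curve hf hp, hp0, deriv_comp_line hψ, deriv_deriv_comp_line hψ]

/-- The columns of `α` have the form `0, l • u, m • u` with `u ≠ 0` and `(l, m) ≠ 0`. -/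
def IsRankOneMonge (α : Matrix (Fin 3) (Fin 3) ℝ) : Prop :=
  ∃ (u : Fin 3 → ℝ) (l m : ℝ), u ≠ 0 ∧ 0 < l ^ 2 + m ^ 2 ∧
    ∀ i, α i 0 = 0 ∧ α i 1 = l * u i ∧ α i 2 = m * u i

lemma mem_curvLocus_iff {α : Matrix (Fin 3) (Fin 3) ℝ} {Q : Fin 3 → (Fin 3 → ℝ) → ℝ}
    (hQ : ∀ i p, Q i p = α i 0 * p 2 ^ 2 + α i 1 * p 0 * p 2 + α i 2 * p 1 * p 2)
    (v : Fin 3 → ℝ) :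
    v ∈ curvLocus Q ↔ ∃ a b c : ℝ, a ^ 2 + b ^ 2 = 1 ∧
      ∀ i, v i = 2 * (α i 0 * c ^ 2 + α i 1 * a * c + α i 2 * b * c) := by
  simp only [curvLocus, Set.mem_ofPred_eq, funext_iff, Fin.forall_fin_succ, hQ]
  simp

lemma isRankOneMonge_iff_locus_line {α : Matrix (Fin 3) (Fin 3) ℝ}
    {Q : Fin 3 → (Fin 3 → ℝ) → ℝ}
    (hQ : ∀ i p, Q i p = α i 0 * p 2 ^ 2 + α i 1 * p 0 * p 2 + α i 2 * p 1 * p 2) :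
    IsRankOneMonge α ↔
      ∃ u : Fin 3 → ℝ, u ≠ 0 ∧ curvLocus Q = {v | ∃ t : ℝ, v = t • u} := by
  constructor
  · rintro ⟨u, l, m, hu, hlm, h⟩
    refine ⟨u, hu, ?_⟩
    ext v
    rw [mem_curvLocus_iff hQ, Set.mem_ofPred_eq]
    constructor
    · rintro ⟨a, b, c, -, hv⟩
      refine ⟨2 * c * (l * a + m * b), funext fun i => ?_⟩
      obtain ⟨h0, h1, h2⟩ := h i
      rw [hv i, h0, h1, h2, Pi.smul_apply, smul_eq_mul]
      ring
    · rintro ⟨t, rfl⟩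
      set r := √(l ^ 2 + m ^ 2)
      have hr : r ^ 2 = l ^ 2 + m ^ 2 := Real.sq_sqrt hlm.le
      have hr0 : r ≠ 0 := (Real.sqrt_pos.2 hlm).ne'
      refine ⟨l / r, m / r, t / (2 * r), ?_, fun i => ?_⟩
      · field_simp
        exact hr.symm
      · obtain ⟨h0, h1, h2⟩ := h i
        rw [h0, h1, h2, Pi.smul_apply, smul_eq_mul]
        field_simp
        rw [hr]
        ring
  · rintro ⟨u, hu, hΔ⟩
    have hline : ∀ a b c : ℝ, a ^ 2 + b ^ 2 = 1 → ∃ t : ℝ, ∀ i,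
        2 * (α i 0 * c ^ 2 + α i 1 * a * c + α i 2 * b * c) = t * u i := by
      intro a b c hab
      have hmem : (fun i => 2 * (α i 0 * c ^ 2 + α i 1 * a * c + α i 2 * b * c)) ∈
          curvLocus Q := (mem_curvLocus_iff hQ _).2 ⟨a, b, c, hab, fun _ => rfl⟩
      rw [hΔ] at hmem
      obtain ⟨t, ht⟩ := hmem
      exact ⟨t, fun i => congrFun ht i⟩
    have hsurj : ∀ t : ℝ, ∃ a b c : ℝ, a ^ 2 + b ^ 2 = 1 ∧
        ∀ i, t * u i = 2 * (α i 0 * c ^ 2 + α i 1 * a * c + α i 2 * b * c) := by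
      intro t
      exact (mem_curvLocus_iff hQ (t • u)).1 (hΔ ▸ ⟨t, rfl⟩)
    obtain ⟨t₁, h₁⟩ := hline 1 0 1 (by norm_num)
    obtain ⟨t₂, h₂⟩ := hline (-1) 0 1 (by norm_num)
    obtain ⟨t₃, h₃⟩ := hline 0 1 1 (by norm_num)
    obtain ⟨j, hj⟩ := Function.ne_iff.1 hu
    obtain ⟨k, hk⟩ : ∃ k, k = (t₁ + t₂) / 4 := ⟨_, rfl⟩
    obtain ⟨l, hl⟩ : ∃ l, l = (t₁ - t₂) / 4 := ⟨_, rfl⟩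
    obtain ⟨m, hm⟩ : ∃ m, m = t₃ / 2 - k := ⟨_, rfl⟩
    have e0 : ∀ i, α i 0 = k * u i := fun i => by
      rw [hk]; linear_combination (h₁ i + h₂ i) / 4
    have e1 : ∀ i, α i 1 = l * u i := fun i => by
      rw [hl]; linear_combination (h₁ i - h₂ i) / 4
    have e2 : ∀ i, α i 2 = m * u i := fun i => by
      rw [hm]; linear_combination h₃ i / 2 - e0 i
    have hscalar : ∀ t : ℝ, ∃ a b c : ℝ, a ^ 2 + b ^ 2 = 1 ∧
        t = 2 * (k * c ^ 2 + l * a * c + m * b * c) := by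
      intro t
      obtain ⟨a, b, c, hab, h⟩ := hsurj t
      refine ⟨a, b, c, hab, mul_right_cancel₀ hj ?_⟩
      rw [h j, e0, e1, e2]
      ring
    have hk0 : k = 0 := by
      by_contra hk0
      obtain ⟨a, b, c, hab, h⟩ := hscalar (-(l ^ 2 + m ^ 2 + 1) / k)
      have hkt : -(l ^ 2 + m ^ 2 + 1) = k * (2 * (k * c ^ 2 + l * a * c + m * b * c)) := by
        rw [← h]; field_simp
      have hd : (l * a + m * b) ^ 2 + (l * b - m * a) ^ 2 = l ^ 2 + m ^ 2 := by
        linear_combination (l ^ 2 + m ^ 2) * hab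
      nlinarith [sq_nonneg (2 * (k * c) + (l * a + m * b)), sq_nonneg (l * b - m * a),
        sq_nonneg l, sq_nonneg m]
    refine ⟨u, l, m, hu, ?_, fun i => ⟨by rw [e0, hk0, zero_mul], e1 i, e2 i⟩⟩
    by_contra hlm
    have hl0 : l = 0 := by nlinarith [sq_nonneg l, sq_nonneg m]
    have hm0 : m = 0 := by nlinarith [sq_nonneg l, sq_nonneg m]
    obtain ⟨a, b, c, -, h⟩ := hscalar 1
    simp [hk0, hl0, hm0] at h

lemma IsRankOneMonge.a2Equiv_g5 {α : Matrix (Fin 3) (Fin 3) ℝ} (hα : IsRankOneMonge α)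
    {Q : Fin 3 → (Fin 3 → ℝ) → ℝ}
    (hQ : ∀ i p, Q i p = α i 0 * p 2 ^ 2 + α i 1 * p 0 * p 2 + α i 2 * p 1 * p 2)
    {f : (Fin 3 → ℝ) → (Fin 5 → ℝ)} (hf : ∀ p, f p = ![p 0, p 1, Q 0 p, Q 1 p, Q 2 p]) :
    A2Equiv f g5 := by
  obtain ⟨u, l, m, hu, hlm, h⟩ := hα
  obtain ⟨d, hd⟩ : ∃ d, d = l ^ 2 + m ^ 2 := ⟨_, rfl⟩
  rw [← hd] at hlm
  have hd0 : d ≠ 0 := hlm.ne'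
  obtain ⟨S, hS⟩ := SeparatingDual.exists_continuousLinearEquiv_apply_eq (R := ℝ) hu
    (y := ![1, 0, 0]) (by simp)
  let Ψ : (Fin 3 → ℝ) ≃ₗ[ℝ] (Fin 3 → ℝ) :=
    { toFun := fun p => ![(l * p 0 - m * p 1) / d, (m * p 0 + l * p 1) / d, p 2]
      map_add' := fun p q => by
        ext i; fin_cases i <;> simp <;> ring
      map_smul' := fun c p => by
        ext i; fin_cases i <;> simp <;> ring
      invFun := fun p => ![l * p 0 + m * p 1, -m * p 0 + l * p 1, p 2]
      left_inv := fun p => by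
        ext i; fin_cases i <;> simp <;> field_simp <;> rw [hd] <;> ring
      right_inv := fun p => by
        ext i; fin_cases i <;> simp <;> field_simp <;> rw [hd] <;> ring }
  let Φ : (Fin 5 → ℝ) ≃ₗ[ℝ] (Fin 5 → ℝ) :=
    { toFun := fun y => ![l * y 0 + m * y 1, -m * y 0 + l * y 1,
        S ![y 2, y 3, y 4] 0, S ![y 2, y 3, y 4] 1, S ![y 2, y 3, y 4] 2]
      map_add' := fun p q => by
        have e : ![(p + q) 2, (p + q) 3, (p + q) 4] =
            ![p 2, p 3, p 4] + ![q 2, q 3, q 4] := by simp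
        rw [e, map_add]
        ext i; fin_cases i <;> simp <;> ring
      map_smul' := fun c p => by
        have e : ![(c • p) 2, (c • p) 3, (c • p) 4] = c • ![p 2, p 3, p 4] := by simp
        rw [e, map_smul]
        ext i; fin_cases i <;> simp <;> ring
      invFun := fun y => ![(l * y 0 - m * y 1) / d, (m * y 0 + l * y 1) / d,
        S.symm ![y 2, y 3, y 4] 0, S.symm ![y 2, y 3, y 4] 1, S.symm ![y 2, y 3, y 4] 2]
      left_inv := fun p => by
        have e : ∀ w : Fin 3 → ℝ, ![w 0, w 1, w 2] = w := fun w => by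
          ext i; fin_cases i <;> rfl
        ext i; fin_cases i <;> simp [e] <;> field_simp <;> rw [hd] <;> ring
      right_inv := fun p => by
        have e : ∀ w : Fin 3 → ℝ, ![w 0, w 1, w 2] = w := fun w => by
          ext i; fin_cases i <;> rfl
        ext i; fin_cases i <;> simp [e] <;> field_simp <;> rw [hd] <;> ring }
  have hcomp : Φ.toContinuousLinearEquiv ∘ f ∘ Ψ.toContinuousLinearEquiv = g5 := by
    funext p
    have hfp : f (Ψ p) = ![(l * p 0 - m * p 1) / d, (m * p 0 + l * p 1) / d,
        (p 0 * p 2) * u 0, (p 0 * p 2) * u 1, (p 0 * p 2) * u 2] := by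
      have hΨ : Ψ p = ![(l * p 0 - m * p 1) / d, (m * p 0 + l * p 1) / d, p 2] := rfl
      have hq : ∀ i, Q i (Ψ p) = (p 0 * p 2) * u i := fun i => by
        obtain ⟨h0, h1, h2⟩ := h i
        rw [hQ, hΨ, h0, h1, h2]
        simp
        field_simp
        rw [hd]
        ring
      rw [hf, hq, hq, hq, hΨ]
      simp
    have e : ![(p 0 * p 2) * u 0, (p 0 * p 2) * u 1, (p 0 * p 2) * u 2] = (p 0 * p 2) • u := by
      ext i; fin_cases i <;> simp
    have k0 : l * ((l * p 0 - m * p 1) / d) + m * ((m * p 0 + l * p 1) / d) = p 0 := by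
      field_simp
      rw [hd]
      ring
    have k1 : -m * ((l * p 0 - m * p 1) / d) + l * ((m * p 0 + l * p 1) / d) = p 1 := by
      field_simp
      rw [hd]
      ring
    have hΦ : ∀ y, Φ y = ![l * y 0 + m * y 1, -m * y 0 + l * y 1,
        S ![y 2, y 3, y 4] 0, S ![y 2, y 3, y 4] 1, S ![y 2, y 3, y 4] 2] := fun _ => rfl
    change Φ (f (Ψ p)) = g5 p
    rw [hfp, hΦ]
    simp only [Matrix.cons_val]
    rw [e, map_smul, hS, k0, k1]
    simp [g5]
  exact ⟨Ψ.toContinuousLinearEquiv, Φ.toContinuousLinearEquiv, Ψ.toContinuousLinearEquiv,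
    Φ.toContinuousLinearEquiv, ContinuousLinearEquiv.contDiff _,
    ContinuousLinearEquiv.contDiff _, map_zero _, map_zero _,
    ContinuousLinearEquiv.hasFDerivAt _, ContinuousLinearEquiv.hasFDerivAt _,
    fun k _ => by rw [hcomp]⟩

lemma A2Equiv.isRankOneMonge {α : Matrix (Fin 3) (Fin 3) ℝ} {Q : Fin 3 → (Fin 3 → ℝ) → ℝ}
    (hQ : ∀ i p, Q i p = α i 0 * p 2 ^ 2 + α i 1 * p 0 * p 2 + α i 2 * p 1 * p 2)
    {f : (Fin 3 → ℝ) → (Fin 5 → ℝ)} (hf : ∀ p, f p = ![p 0, p 1, Q 0 p, Q 1 p, Q 2 p])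
    (h : A2Equiv f g5) : IsRankOneMonge α := by
  obtain ⟨ψ, φ, Ψ, Φ, hψ, hφ, hψ0, -, hΨ, hΦ, hjet⟩ := h
  have hfs : ContDiff ℝ ∞ f := by
    rw [contDiff_pi]
    intro i
    fin_cases i <;> simp [hf, hQ] <;> fun_prop
  have hgs : ContDiff ℝ ∞ g5 := by
    rw [contDiff_pi]
    intro i
    fin_cases i <;> simp [g5] <;> fun_prop
  have hf0 : f 0 = 0 := by
    rw [hf]; ext i; fin_cases i <;> simp [hQ]
  have hfd : ∀ w, fderiv ℝ f 0 w = ![w 0, w 1, 0, 0, 0] ∧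
      fderiv ℝ (fderiv ℝ f) 0 w w = (2 : ℝ) • ![0, 0, Q 0 w, Q 1 w, Q 2 w] := fun w => by
    refine fderiv_of_quadratic_on_line hfs fun t => ?_
    rw [hf]; ext i; fin_cases i <;> simp [hQ] <;> ring
  have hgd : ∀ w, fderiv ℝ g5 0 w = ![w 0, w 1, 0, 0, 0] ∧
      fderiv ℝ (fderiv ℝ g5) 0 w w = (2 : ℝ) • ![0, 0, w 0 * w 2, 0, 0] := fun w => by
    refine fderiv_of_quadratic_on_line hgs fun t => ?_
    ext i; fin_cases i <;> simp [g5] ; ring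
  have hjet₁ : ∀ v, fderiv ℝ (φ ∘ f ∘ ψ) 0 v = fderiv ℝ g5 0 v := fun v => by
    simpa using congrArg (fun M => M fun _ => v) (hjet 1 (by norm_num))
  have hjet₂ : ∀ v, fderiv ℝ (fderiv ℝ (φ ∘ f ∘ ψ)) 0 v v = fderiv ℝ (fderiv ℝ g5) 0 v v :=
    fun v => by
      simpa [iteratedFDeriv_two_apply] using
        congrArg (fun M => M fun _ => v) (hjet 2 le_rfl)
  have hchain := fun v => fderiv_fderiv_comp_comp hψ hfs hφ hψ0 hf0 v
  simp only [hΨ.fderiv, hΦ.fderiv, hjet₁, hjet₂, (hgd _).1, (hgd _).2, (hfd _).1, (hfd _).2,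
    ContinuousLinearEquiv.coe_coe] at hchain
  -- the linear parts intertwine the projections
  have hlin : ∀ v, ![Ψ v 0, Ψ v 1, 0, 0, 0] = Φ.symm ![v 0, v 1, 0, 0, 0] := fun v => by
    rw [(hchain v).1, Φ.symm_apply_apply]
  obtain ⟨ε, hε⟩ : ∃ ε : Fin 5 → ℝ, ε = Φ.symm ![0, 0, 1, 0, 0] := ⟨_, rfl⟩
  obtain ⟨β, hβ⟩ : ∃ β : (Fin 5 → ℝ) → (Fin 5 → ℝ), ∀ y, β y = Φ.symm
    (fderiv ℝ (fderiv ℝ φ) 0 (Φ.symm y) (Φ.symm y)) := ⟨_, fun _ => rfl⟩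
  have hquad : ∀ v, (2 * (v 0 * v 2)) • ε = β ![v 0, v 1, 0, 0, 0] +
      ((2 : ℝ) • ![0, 0, Q 0 (Ψ v), Q 1 (Ψ v), Q 2 (Ψ v)] +
        ![fderiv ℝ (fderiv ℝ ψ) 0 v v 0, fderiv ℝ (fderiv ℝ ψ) 0 v v 1, 0, 0, 0]) := fun v => by
    have e : (2 : ℝ) • ![0, 0, v 0 * v 2, 0, 0] =
        (2 * (v 0 * v 2)) • (![0, 0, 1, 0, 0] : Fin 5 → ℝ) := by
      ext i; fin_cases i <;> simp
    have := congrArg Φ.symm (hchain v).2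
    rw [e, map_smul, ← hε, map_add, Φ.symm_apply_apply, hlin, ← hβ] at this
    exact this
  obtain ⟨u, hu⟩ : ∃ u : Fin 3 → ℝ, u = ![ε 2, ε 3, ε 4] := ⟨_, rfl⟩
  obtain ⟨b, hb⟩ : ∃ b : ℝ → ℝ → Fin 3 → ℝ, ∀ x y, b x y =
    ![β ![x, y, 0, 0, 0] 2, β ![x, y, 0, 0, 0] 3, β ![x, y, 0, 0, 0] 4] := ⟨_, fun _ _ => rfl⟩
  have hq : ∀ v i, 2 * (v 0 * v 2) * u i = b (v 0) (v 1) i + 2 * Q i (Ψ v) := fun v i => by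
    have h2 := congrFun (hquad v) 2
    have h3 := congrFun (hquad v) 3
    have h4 := congrFun (hquad v) 4
    simp at h2 h3 h4
    rw [hb, hu]
    fin_cases i <;> simp <;> assumption
  have hb0 : ∀ i, b 0 0 i = 0 := fun i => by
    have := hq 0 i
    simpa [hQ] using this.symm
  obtain ⟨z, hz⟩ : ∃ z : Fin 3 → ℝ, z = ![0, 0, 1] := ⟨_, rfl⟩
  obtain ⟨hz0, hz1⟩ : Ψ z 0 = 0 ∧ Ψ z 1 = 0 := by
    have := hlin z
    have e : (![z 0, z 1, 0, 0, 0] : Fin 5 → ℝ) = 0 := by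
      ext i; fin_cases i <;> simp [hz]
    rw [e, map_zero] at this
    exact ⟨congrFun this 0, congrFun this 1⟩
  have hz2 : Ψ z 2 ≠ 0 := fun h2 => by
    have : Ψ z = 0 := by
      ext i; fin_cases i <;> assumption
    rw [map_eq_zero_iff _ Ψ.injective] at this
    simpa [hz] using congrFun this 2
  have hα0 : ∀ i, α i 0 = 0 := fun i => by
    have := hq z i
    rw [hQ, hz0, hz1, show z 0 = 0 by simp [hz], show z 1 = 0 by simp [hz]] at this
    simpa [hb0, hz2] using this
  have hmix : ∀ v i, (α i 1 * Ψ v 0 + α i 2 * Ψ v 1) * Ψ z 2 = v 0 * u i := fun v i => by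
    have h1 := hq v i
    have h2 := hq (v + z) i
    rw [hQ, hα0] at h1 h2
    rw [map_add] at h2
    simp only [Pi.add_apply, hz0, hz1] at h2
    simp only [hz, Matrix.cons_val] at h1 h2 ⊢
    simp only [add_zero] at h2
    linear_combination (h1 - h2) / 2
  have hu0 : u ≠ 0 := fun h0 => by
    rw [hu] at h0
    have hε' : ![ε 0, ε 1, 0, 0, 0] = ε := by
      have h2 := congrFun h0 0
      have h3 := congrFun h0 1
      have h4 := congrFun h0 2
      simp at h2 h3 h4
      ext i; fin_cases i <;> simp [h2, h3, h4]
    have := hlin (Ψ.symm ![ε 0, ε 1, 0])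
    rw [Ψ.apply_symm_apply] at this
    simp only [Matrix.cons_val] at this
    rw [hε', hε] at this
    simpa using congrFun (Φ.symm.injective this) 2
  obtain ⟨l, hl⟩ : ∃ l, l = Ψ.symm ![1, 0, 0] 0 / Ψ z 2 := ⟨_, rfl⟩
  obtain ⟨m, hm⟩ : ∃ m, m = Ψ.symm ![0, 1, 0] 0 / Ψ z 2 := ⟨_, rfl⟩
  have e1 : ∀ i, α i 1 = l * u i := fun i => by
    have := hmix (Ψ.symm ![1, 0, 0]) i
    rw [Ψ.apply_symm_apply] at this
    simp at this
    rw [hl, div_mul_eq_mul_div, eq_div_iff hz2, this]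
  have e2 : ∀ i, α i 2 = m * u i := fun i => by
    have := hmix (Ψ.symm ![0, 1, 0]) i
    rw [Ψ.apply_symm_apply] at this
    simp at this
    rw [hm, div_mul_eq_mul_div, eq_div_iff hz2, this]
  refine ⟨u, l, m, hu0, ?_, fun i => ⟨hα0 i, e1 i, e2 i⟩⟩
  by_contra hlm
  have hl0 : l = 0 := by nlinarith [sq_nonneg l, sq_nonneg m]
  have hm0 : m = 0 := by nlinarith [sq_nonneg l, sq_nonneg m]
  refine hu0 (funext fun i => ?_)
  have := hmix ![1, 0, 0] i
  rw [e1, e2, hl0, hm0] at this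
  simpa using this.symm

/-- For the special Monge form, `𝒜²`-equivalence to `(x,y,xz,0,0)` is characterised
by the curvature locus being a line through the origin. -/
theorem A2_equiv_g5_iff_locus_line
    (α : Matrix (Fin 3) (Fin 3) ℝ) (Q : Fin 3 → (Fin 3 → ℝ) → ℝ)
    (hQ : ∀ i p, Q i p = α i 0 * p 2 ^ 2 + α i 1 * p 0 * p 2 + α i 2 * p 1 * p 2)
    (f : (Fin 3 → ℝ) → (Fin 5 → ℝ))
    (hf : ∀ p, f p = ![p 0, p 1, Q 0 p, Q 1 p, Q 2 p]) :
    A2Equiv f g5 ↔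
      ∃ u : Fin 3 → ℝ, u ≠ 0 ∧ curvLocus Q = {v | ∃ t : ℝ, v = t • u} := by
  rw [← isRankOneMonge_iff_locus_line hQ]
  exact ⟨fun h => h.isRankOneMonge hQ hf, fun h => h.a2Equiv_g5 hQ hf⟩
end
end

section
/- The nets of quadrics q(x,y,z) = (x² + yz, z² − yz, xz + yz) and q'(x,y,z) = (y² + 2z², xz, yz) are equivalent under the group GL(3,ℝ) × GL(3,ℝ): there exist invertible linear maps P : ℝ³ → ℝ³ and Q : ℝ³ → ℝ³ such that Q(q(P(v))) = q'(v) for all v ∈ ℝ³. -/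
noncomputable section

/-- The net of quadrics `q(x,y,z) = (x² + yz, z² − yz, xz + yz)`. -/
def netQ : (Fin 3 → ℝ) → (Fin 3 → ℝ) := fun p =>
  ![p 0 ^ 2 + p 1 * p 2, p 2 ^ 2 - p 1 * p 2, p 0 * p 2 + p 1 * p 2]

/-- The net of quadrics `q'(x,y,z) = (y² + 2z², xz, yz)`. -/
def netQ' : (Fin 3 → ℝ) → (Fin 3 → ℝ) := fun p =>
  ![p 1 ^ 2 + 2 * p 2 ^ 2, p 0 * p 2, p 1 * p 2]

/-- The source coordinate change `(x,y,z) ↦ (y − z, z − x, z)`. -/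
def sourceChange : (Fin 3 → ℝ) ≃ₗ[ℝ] (Fin 3 → ℝ) where
  toFun p := ![p 1 - p 2, p 2 - p 0, p 2]
  invFun p := ![p 2 - p 1, p 0 + p 2, p 2]
  map_add' p q := by ext i; fin_cases i <;> simp <;> ring
  map_smul' c p := by ext i; fin_cases i <;> simp <;> ring
  left_inv p := by ext i; fin_cases i <;> simp
  right_inv p := by ext i; fin_cases i <;> simp

/-- The target coordinate change `(a,b,c) ↦ (a + 3b + 2c, b, b + c)`. -/
def targetChange : (Fin 3 → ℝ) ≃ₗ[ℝ] (Fin 3 → ℝ) where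
  toFun p := ![p 0 + 3 * p 1 + 2 * p 2, p 1, p 1 + p 2]
  invFun p := ![p 0 - p 1 - 2 * p 2, p 1, p 2 - p 1]
  map_add' p q := by ext i; fin_cases i <;> simp <;> ring
  map_smul' c p := by ext i; fin_cases i <;> simp <;> ring
  left_inv p := by ext i; fin_cases i <;> simp; ring
  right_inv p := by ext i; fin_cases i <;> simp; ring

/-- The nets `(x² + yz, z² − yz, xz + yz)` and `(y² + 2z², xz, yz)` are
equivalent under `GL(3,ℝ) × GL(3,ℝ)`. -/
theorem nets_G_equivalent :
    ∃ (P Q : (Fin 3 → ℝ) ≃ₗ[ℝ] (Fin 3 → ℝ)), ∀ v, Q (netQ (P v)) = netQ' v := by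
  refine ⟨sourceChange, targetChange, fun v => ?_⟩
  ext i
  fin_cases i <;> simp [sourceChange, targetChange, netQ, netQ'] <;> ring
end
end
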